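/- arXiv:1907.12329 — 4 statements merged into one kernel-verified Lean document; each statement's English description precedes it below -/
import Mathlib

section
/- If m and n are positive integers with m ≡ 0 (mod 8) and n ≡ 0 (mod 2), then the graph K_m □ K_n has an L_8-decomposition. -/
open SimpleGraph

/-- The sunlet graph `L₈` on 8 vertices: a 4-cycle on vertices `0,1,2,3`
together with pendant vertices `4,5,6,7`, where pendant `i+4` is attached
to cycle vertex `i`. -/
def sunlet8 : SimpleGraph (Fin 8) :=
  SimpleGraph.fromRel (fun a b =>
    (a.val < 4 ∧ b.val < 4 ∧ b.val = (a.val + 1) % 4) ∨ (a.val < 4 ∧ b.val = a.val + 4))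

/-- A set of edges is a copy of the sunlet graph `L₈` if it is the image of the
edge set of `sunlet8` under an injective map of vertices. -/
def IsSunletCopy {V : Type*} (s : Set (Sym2 V)) : Prop :=
  ∃ f : Fin 8 → V, Function.Injective f ∧ s = Sym2.map f '' sunlet8.edgeSet

/-- A graph `G` has an `L₈`-decomposition if its edge set can be partitioned into
parts, each of which induces a subgraph isomorphic to the sunlet graph `L₈`. -/
def HasSunletDecomposition {V : Type*} (G : SimpleGraph V) : Prop :=
  ∃ P : Set (Set (Sym2 V)),
    ⋃₀ P = G.edgeSet ∧ P.PairwiseDisjoint id ∧ ∀ s ∈ P, IsSunletCopy s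

section general
variable {V W U T : Type*}

lemma hsd_iSup {ι : Type*} (G : ι → SimpleGraph V)
    (hd : ∀ i j, ∀ u v, (G i).Adj u v → (G j).Adj u v → i = j)
    (h : ∀ i, HasSunletDecomposition (G i)) : HasSunletDecomposition (⨆ i, G i) := by
  choose P h1 h2 h3 using h
  refine ⟨⋃ i, P i, ?_, ?_, ?_⟩
  · ext e
    rw [SimpleGraph.edgeSet_iSup]
    simp only [Set.mem_sUnion, Set.mem_iUnion, ← h1]
    constructor
    · rintro ⟨s, ⟨i, hi⟩, he⟩
      exact ⟨i, s, hi, he⟩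
    · rintro ⟨i, s, hi, he⟩
      exact ⟨s, ⟨i, hi⟩, he⟩
  · intro s hs t ht hst
    simp only [Set.mem_iUnion] at hs ht
    obtain ⟨i, hi⟩ := hs
    obtain ⟨j, hj⟩ := ht
    rw [Function.onFun, Set.disjoint_left]
    intro e hes het
    have hei : e ∈ (G i).edgeSet := by rw [← h1]; exact ⟨s, hi, hes⟩
    have hej : e ∈ (G j).edgeSet := by rw [← h1]; exact ⟨t, hj, het⟩
    have hij : i = j := by
      induction e with
      | h u v => exact hd i j u v hei hej
    subst hij
    exact Set.disjoint_left.1 (h2 i hi hj hst) hes het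
  · intro s hs
    simp only [Set.mem_iUnion] at hs
    obtain ⟨i, hi⟩ := hs
    exact h3 i s hi

lemma hsd_sup {G H : SimpleGraph V} (hd : ∀ u v, G.Adj u v → H.Adj u v → False)
    (hG : HasSunletDecomposition G) (hH : HasSunletDecomposition H) :
    HasSunletDecomposition (G ⊔ H) := by
  rw [sup_eq_iSup]
  apply hsd_iSup
  · intro i j u v h1 h2
    cases i <;> cases j <;> simp at h1 h2 ⊢
    · exact hd u v h2 h1
    · exact hd u v h1 h2
  · intro i
    cases i <;> simpa

lemma hsd_map {G : SimpleGraph V} (f : V ↪ W) (h : HasSunletDecomposition G) :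
    HasSunletDecomposition (G.map f) := by
  obtain ⟨P, h1, h2, h3⟩ := h
  refine ⟨(fun s => Sym2.map f '' s) '' P, ?_, ?_, ?_⟩
  · rw [SimpleGraph.edgeSet_map, ← h1]
    ext e
    simp only [Set.mem_sUnion, Set.mem_image, Function.Embedding.sym2Map_apply]
    constructor
    · rintro ⟨_, ⟨s, hs, rfl⟩, x, hx, rfl⟩
      exact ⟨x, ⟨s, hs, hx⟩, rfl⟩
    · rintro ⟨x, ⟨s, hs, hx⟩, rfl⟩
      exact ⟨_, ⟨s, hs, rfl⟩, x, hx, rfl⟩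
  · rintro _ ⟨s, hs, rfl⟩ _ ⟨t, ht, rfl⟩ hst
    have : s ≠ t := by rintro rfl; exact hst rfl
    exact (Set.disjoint_image_iff (Sym2.map.injective f.injective)).2 (h2 hs ht this)
  · rintro _ ⟨s, hs, rfl⟩
    obtain ⟨g, hg, rfl⟩ := h3 s hs
    refine ⟨f ∘ g, f.injective.comp hg, ?_⟩
    simp only [← Set.image_comp, Sym2.map_comp]

lemma hsd_iso {G : SimpleGraph V} {H : SimpleGraph W} (e : G ≃g H)
    (h : HasSunletDecomposition G) : HasSunletDecomposition H := by
  have := hsd_map e.toEquiv.toEmbedding h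
  convert this
  ext u v
  simp only [SimpleGraph.map_adj]
  constructor
  · intro hh
    refine ⟨e.symm u, e.symm v, ?_, ?_, ?_⟩
    · exact (e.symm.map_adj_iff).2 hh
    · exact e.apply_symm_apply u
    · exact e.apply_symm_apply v
  · rintro ⟨a, b, hab, rfl, rfl⟩
    exact e.map_adj_iff.2 hab

/-- `K_U □ K_W` -/
abbrev KK (U W : Type*) : SimpleGraph (U × W) := (⊤ : SimpleGraph U) □ (⊤ : SimpleGraph W)

lemma kk_congr (e : U ≃ V) (e' : W ≃ T) (h : HasSunletDecomposition (KK U W)) :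
    HasSunletDecomposition (KK V T) := by
  refine hsd_iso (⟨e.prodCongr e', ?_⟩ : KK U W ≃g KK V T) h
  rintro ⟨a, b⟩ ⟨c, d⟩
  simp [SimpleGraph.boxProd_adj]

lemma kk_comm (h : HasSunletDecomposition (KK U W)) : HasSunletDecomposition (KK W U) :=
  hsd_iso (SimpleGraph.boxProdComm _ _) h

lemma kk_sum (h1 : HasSunletDecomposition (KK U W)) (h2 : HasSunletDecomposition (KK T W))
    (h3 : HasSunletDecomposition (completeBipartiteGraph U T)) :
    HasSunletDecomposition (KK (U ⊕ T) W) := by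
  let f1 : U × W ↪ (U ⊕ T) × W := Function.Embedding.prodMap .inl (.refl W)
  let f2 : T × W ↪ (U ⊕ T) × W := Function.Embedding.prodMap .inr (.refl W)
  let f3 : W → (U ⊕ T ↪ (U ⊕ T) × W) := fun w => ⟨fun x => (x, w), fun a b h => by simpa using h⟩
  have hf3 : ∀ w x, f3 w x = (x, w) := fun _ _ => rfl
  have hf1 : ∀ u w, f1 (u, w) = (.inl u, w) := fun _ _ => rfl
  have hf2 : ∀ u w, f2 (u, w) = (.inr u, w) := fun _ _ => rfl
  have hh : KK (U ⊕ T) W = ((KK U W).map f1 ⊔ (KK T W).map f2) ⊔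
      ⨆ w, (completeBipartiteGraph U T).map (f3 w) := by
    ext ⟨a, b⟩ ⟨c, d⟩
    simp only [SimpleGraph.sup_adj, SimpleGraph.iSup_adj, SimpleGraph.map_adj]
    rcases a with a | a <;> rcases c with c | c <;>
      simp [hf1, hf2, hf3, SimpleGraph.boxProd_adj]
  rw [hh]
  refine hsd_sup ?_ (hsd_sup ?_ (hsd_map _ h1) (hsd_map _ h2)) (hsd_iSup _ ?_ fun w => hsd_map _ h3)
  · rintro ⟨a, b⟩ ⟨c, d⟩
    simp only [SimpleGraph.sup_adj, SimpleGraph.iSup_adj, SimpleGraph.map_adj]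
    rcases a with a | a <;> rcases c with c | c <;> simp [hf1, hf2, hf3]
  · rintro ⟨a, b⟩ ⟨c, d⟩
    simp only [SimpleGraph.map_adj]
    rcases a with a | a <;> rcases c with c | c <;> simp [hf1, hf2]
  · rintro i j ⟨a, b⟩ ⟨c, d⟩
    simp only [SimpleGraph.map_adj]
    rintro ⟨_, _, _, h1, _⟩ ⟨_, _, _, h2, _⟩
    simp only [hf3, Prod.mk.injEq] at h1 h2
    rw [h1.2, h2.2]

lemma bip_sum (h1 : HasSunletDecomposition (completeBipartiteGraph U T))
    (h2 : HasSunletDecomposition (completeBipartiteGraph W T)) :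
    HasSunletDecomposition (completeBipartiteGraph (U ⊕ W) T) := by
  let f1 : U ⊕ T ↪ (U ⊕ W) ⊕ T := Function.Embedding.sumMap .inl (.refl T)
  let f2 : W ⊕ T ↪ (U ⊕ W) ⊕ T := Function.Embedding.sumMap .inr (.refl T)
  have hh : completeBipartiteGraph (U ⊕ W) T =
      ((completeBipartiteGraph U T).map f1 ⊔ (completeBipartiteGraph W T).map f2) := by
    ext a c
    simp only [SimpleGraph.sup_adj, SimpleGraph.map_adj]
    rcases a with (a | a) | a <;> rcases c with (c | c) | c <;>
      simp [f1, f2]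
  rw [hh]
  refine hsd_sup ?_ (hsd_map _ h1) (hsd_map _ h2)
  intro a c
  simp only [SimpleGraph.map_adj]
  rcases a with (a | a) | a <;> rcases c with (c | c) | c <;> simp [f1, f2]

lemma bip_congr (e : U ≃ V) (e' : W ≃ T)
    (h : HasSunletDecomposition (completeBipartiteGraph U W)) :
    HasSunletDecomposition (completeBipartiteGraph V T) := by
  refine hsd_iso (⟨e.sumCongr e', ?_⟩ : completeBipartiteGraph U W ≃g completeBipartiteGraph V T) h
  rintro (a | a) (b | b) <;> simp

lemma bip_comm (h : HasSunletDecomposition (completeBipartiteGraph U W)) :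
    HasSunletDecomposition (completeBipartiteGraph W U) := by
  refine hsd_iso (⟨Equiv.sumComm U W, ?_⟩ :
    completeBipartiteGraph U W ≃g completeBipartiteGraph W U) h
  rintro (a | a) (b | b) <;> simp

/-- the eight edges of a sunlet -/
def E8 (f : Fin 8 → V) : List (Sym2 V) :=
  [s(f 0, f 1), s(f 1, f 2), s(f 2, f 3), s(f 3, f 0),
   s(f 0, f 4), s(f 1, f 5), s(f 2, f 6), s(f 3, f 7)]

instance : DecidableRel sunlet8.Adj := by
  unfold sunlet8
  infer_instance

lemma sunlet8_edges : ∀ e : Sym2 (Fin 8), e ∈ sunlet8.edgeSet ↔ e ∈ E8 (id : Fin 8 → Fin 8) := by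
  decide +kernel

lemma mem_copy (f : Fin 8 → V) (e : Sym2 V) :
    e ∈ Sym2.map f '' sunlet8.edgeSet ↔ e ∈ E8 f := by
  have h : E8 f = (E8 (id : Fin 8 → Fin 8)).map (Sym2.map f) := by simp [E8]
  rw [h, List.mem_map]
  simp only [Set.mem_image, sunlet8_edges]

lemma hsd_list (G : SimpleGraph V) (L : List (Fin 8 → V)) (hinj : ∀ f ∈ L, Function.Injective f)
    (hmem : ∀ f ∈ L, ∀ e ∈ E8 f, e ∈ G.edgeSet)
    (hcov : ∀ u v, G.Adj u v → s(u, v) ∈ L.flatMap E8)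
    (hnd : (L.flatMap E8).Nodup) : HasSunletDecomposition G := by
  refine ⟨{s | ∃ f ∈ L, s = Sym2.map f '' sunlet8.edgeSet}, ?_, ?_, ?_⟩
  · ext e
    simp only [Set.mem_sUnion, Set.mem_ofPred_eq]
    constructor
    · rintro ⟨_, ⟨f, hf, rfl⟩, he⟩
      exact hmem f hf e ((mem_copy f e).1 he)
    · intro he
      induction e with
      | h u v =>
        obtain ⟨f, hf, h⟩ := List.mem_flatMap.1 (hcov u v he)
        exact ⟨_, ⟨f, hf, rfl⟩, (mem_copy f _).2 h⟩
  · rintro _ ⟨f, hf, rfl⟩ _ ⟨g, hg, rfl⟩ hfg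
    have hne : f ≠ g := by rintro rfl; exact hfg rfl
    have h2 := (List.nodup_flatMap.1 hnd).2
    have : Std.Symm fun a b : Fin 8 → V => List.Disjoint (E8 a) (E8 b) :=
      ⟨fun a b h => h.symm⟩
    have h3 : List.Disjoint (E8 f) (E8 g) :=
      (List.Pairwise.forall (R := fun a b => List.Disjoint (E8 a) (E8 b)) h2) hf hg hne
    rw [Function.onFun, Set.disjoint_left]
    intro e he he'
    exact h3 ((mem_copy f e).1 he) ((mem_copy g e).1 he')
  · rintro _ ⟨f, hf, rfl⟩
    exact ⟨f, hinj f hf, rfl⟩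

/-- numerical code of an edge -/
def ecode (c : V → ℕ) : Sym2 V → ℕ :=
  Sym2.lift ⟨fun a b => min (c a) (c b) * 128 + max (c a) (c b), fun _ _ => by
    simp only [min_comm, max_comm]⟩

lemma ecode_inj (c : V → ℕ) (hc : Function.Injective c) (hb : ∀ v, c v < 128) :
    Function.Injective (ecode c) := by
  intro e e' h
  induction e with
  | h a b =>
    induction e' with
    | h a' b' =>
      simp only [ecode, Sym2.lift_mk] at h
      have := hb a
      have := hb b
      have := hb a'
      have := hb b'
      have key : (c a = c a' ∧ c b = c b') ∨ (c a = c b' ∧ c b = c a') := by omega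
      rw [Sym2.eq_iff]
      rcases key with ⟨h1, h2⟩ | ⟨h1, h2⟩
      · exact Or.inl ⟨hc h1, hc h2⟩
      · exact Or.inr ⟨hc h1, hc h2⟩

lemma hsd_code (G : SimpleGraph V) (c : V → ℕ) (hc : Function.Injective c) (hb : ∀ v, c v < 128)
    (L : List (Fin 8 → V)) (hinj : ∀ f ∈ L, Function.Injective f)
    (hmem : ∀ f ∈ L, ∀ e ∈ E8 f, e ∈ G.edgeSet)
    (C : List ℕ) (hC : C = (L.flatMap E8).map (ecode c))
    (hcov : ∀ u v, G.Adj u v → c u < c v → c u * 128 + c v ∈ C)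
    (hnd : C.Nodup) : HasSunletDecomposition G := by
  subst hC
  refine hsd_list G L hinj hmem ?_ (List.Nodup.of_map _ hnd)
  have main : ∀ u v, G.Adj u v → c u < c v → s(u, v) ∈ L.flatMap E8 := by
    intro u v h hlt
    have h1 := hcov u v h hlt
    rw [List.mem_map] at h1
    obtain ⟨e, he, h2⟩ := h1
    have : e = s(u, v) := by
      apply ecode_inj c hc hb
      rw [h2]
      simp only [ecode, Sym2.lift_mk]
      rw [min_eq_left hlt.le, max_eq_right hlt.le]
    rwa [← this]
  intro u v h
  rcases lt_trichotomy (c u) (c v) with h1 | h1 | h1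
  · exact main u v h h1
  · exact absurd (hc h1) h.ne
  · rw [Sym2.eq_swap]
    exact main v u h.symm h1

end general

/-- vertex code for `K_8 □ K_r` -/
def pc (r : ℕ) (v : Fin 8 × Fin r) : ℕ := v.1.val + 8 * v.2.val

def pd (r : ℕ) [NeZero r] (t : List ℕ) (i : Fin 8) : Fin 8 × Fin r :=
  (Fin.ofNat 8 (t.getD i 0), Fin.ofNat r (t.getD i 0 / 8))

lemma pc_inj (r : ℕ) : Function.Injective (pc r) := by
  rintro ⟨a, b⟩ ⟨c, d⟩ h
  simp only [pc] at h
  have := a.2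
  have := c.2
  ext <;> simp <;> omega

lemma pc_lt (r : ℕ) (hr : r ≤ 10) (v : Fin 8 × Fin r) : pc r v < 128 := by
  have := v.1.2
  have := v.2.2
  simp only [pc]
  omega

/-- the edge codes of a sunlet given by vertex codes -/
def ncodes (t : List ℕ) : List ℕ :=
  [(0, 1), (1, 2), (2, 3), (3, 0), (0, 4), (1, 5), (2, 6), (3, 7)].map fun p =>
    min (t.getD p.1 0) (t.getD p.2 0) * 128 + max (t.getD p.1 0) (t.getD p.2 0)

lemma ecode_pd (r : ℕ) [NeZero r] (L : List (List ℕ))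
    (h : ∀ t ∈ L, ∀ i : Fin 8, pc r (pd r t i) = t.getD i 0) :
    L.flatMap ncodes = ((L.map (pd r)).flatMap E8).map (ecode (pc r)) := by
  rw [List.flatMap_map, List.map_flatMap]
  apply List.flatMap_congr
  intro t ht
  simp [ncodes, E8, ecode, h t ht]

/-- Boolean test for duplicates, by bit masks. -/
def nd : List ℕ → ℕ → Bool
  | [], _ => true
  | x :: xs, acc => cond (acc.testBit x) false (nd xs (acc ||| 1 <<< x))

/-- bit mask of a list -/
def mask : List ℕ → ℕ → ℕ
  | [], acc => acc
  | x :: xs, acc => mask xs (acc ||| 1 <<< x)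

lemma testBit_or_shift (acc x y : ℕ) :
    (acc ||| 1 <<< x).testBit y = true ↔ acc.testBit y = true ∨ y = x := by
  rw [Nat.testBit_or, Nat.one_shiftLeft, Nat.testBit_two_pow, Bool.or_eq_true, decide_eq_true_iff,
    eq_comm (a := x)]

lemma nd_spec (l : List ℕ) : ∀ acc, nd l acc = true →
    l.Nodup ∧ ∀ x ∈ l, acc.testBit x ≠ true := by
  induction l with
  | nil => intro acc _; simp
  | cons x xs ih =>
    intro acc h
    rw [nd] at h
    cases hx : acc.testBit x with
    | true => rw [hx] at h; simp at h
    | false =>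
      rw [hx] at h
      obtain ⟨h1, h2⟩ := ih _ h
      refine ⟨List.nodup_cons.2 ⟨fun hm => h2 x hm ((testBit_or_shift _ _ _).2 (Or.inr rfl)), h1⟩, ?_⟩
      intro y hy
      rcases List.mem_cons.1 hy with rfl | hy
      · simp [hx]
      · exact fun hh => h2 y hy ((testBit_or_shift _ _ _).2 (Or.inl hh))

lemma mask_spec (l : List ℕ) : ∀ acc y, (mask l acc).testBit y = true →
    acc.testBit y = true ∨ y ∈ l := by
  induction l with
  | nil => intro acc y h; exact Or.inl h
  | cons x xs ih =>
    intro acc y h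
    rcases ih _ y h with h | h
    · rcases (testBit_or_shift _ _ _).1 h with h | h
      · exact Or.inl h
      · exact Or.inr (by simp [h])
    · exact Or.inr (by simp [h])

/-- numerical adjacency -/
def adjN (a b : ℕ) : Bool :=
  cond (Nat.beq a b) false (cond (Nat.beq (a % 8) (b % 8)) true (Nat.beq (a / 8) (b / 8)))

lemma adjN_iff (r : ℕ) (u v : Fin 8 × Fin r) :
    adjN (pc r u) (pc r v) = true ↔ (KK (Fin 8) (Fin r)).Adj u v := by
  obtain ⟨a, b⟩ := u
  obtain ⟨c, d⟩ := v
  have ha := a.2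
  have hc := c.2
  have h1 : (a.val + 8 * b.val) % 8 = a.val := by omega
  have h2 : (a.val + 8 * b.val) / 8 = b.val := by omega
  have h3 : (c.val + 8 * d.val) % 8 = c.val := by omega
  have h4 : (c.val + 8 * d.val) / 8 = d.val := by omega
  simp only [adjN, pc, h1, h2, h3, h4, SimpleGraph.boxProd_adj, SimpleGraph.top_adj, Fin.ext_iff,
    ne_eq, Bool.cond_eq_ite, Nat.beq_eq]
  split_ifs <;> simp <;> omega

/-- all `i < n` satisfy `p` -/
def allLt (p : ℕ → Bool) : ℕ → Bool
  | 0 => true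
  | n + 1 => cond (p n) (allLt p n) false

lemma allLt_spec (p : ℕ → Bool) (n : ℕ) (h : allLt p n = true) : ∀ i < n, p i = true := by
  induction n with
  | zero => intro i hi; omega
  | succ n ih =>
    rw [allLt] at h
    cases hp : p n with
    | false => rw [hp] at h; simp at h
    | true =>
      rw [hp] at h
      intro i hi
      rcases Nat.lt_succ_iff_lt_or_eq.1 hi with h1 | rfl
      · exact ih h i h1
      · exact hp

/-- local test of one sunlet in `K_8 □ K_r` -/
def good (r : ℕ) (t : List ℕ) : Bool :=
  allLt (fun i => Nat.blt (t.getD i 0) (8 * r)) 8 && nd t 0 && Nat.beq t.length 8 &&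
  adjN (t.getD 0 0) (t.getD 1 0) && adjN (t.getD 1 0) (t.getD 2 0) &&
  adjN (t.getD 2 0) (t.getD 3 0) && adjN (t.getD 3 0) (t.getD 0 0) &&
  adjN (t.getD 0 0) (t.getD 4 0) && adjN (t.getD 1 0) (t.getD 5 0) &&
  adjN (t.getD 2 0) (t.getD 6 0) && adjN (t.getD 3 0) (t.getD 7 0)

/-- coverage test -/
def covers (r M : ℕ) : Bool :=
  allLt (fun a => allLt (fun b => cond (adjN a b) (M.testBit (a * 128 + b)) true || Nat.ble b a)
    (8 * r)) (8 * r)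

lemma kk_check (r : ℕ) [NeZero r] (hr : r ≤ 10) (L : List (List ℕ)) (h1 : L.all (good r) = true)
    (h2 : nd (L.flatMap ncodes) 0 = true) (h3 : covers r (mask (L.flatMap ncodes) 0) = true) :
    HasSunletDecomposition (KK (Fin 8) (Fin r)) := by
  rw [List.all_eq_true] at h1
  have hpc : ∀ t ∈ L, ∀ i : Fin 8, pc r (pd r t i) = t.getD i 0 := by
    intro t ht i
    have h := h1 t ht
    simp only [good, Bool.and_eq_true] at h
    have h := allLt_spec _ _ h.1.1.1.1.1.1.1.1.1.1 i i.2
    simp only [Nat.blt_eq] at h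
    simp only [pc, pd, Fin.val_ofNat]
    rw [Nat.mod_eq_of_lt (a := t.getD i 0 / 8) (b := r) (by omega)]
    omega
  refine hsd_code _ (pc r) (pc_inj r) (pc_lt r hr) (L.map (pd r)) ?_ ?_
    (L.flatMap ncodes) (ecode_pd r L hpc) ?_ (nd_spec _ _ h2).1
  · rw [List.forall_mem_map]
    intro t ht i j hij
    have h := h1 t ht
    simp only [good, Bool.and_eq_true] at h
    have hn := (nd_spec _ _ h.1.1.1.1.1.1.1.1.1.2).1
    have hl := Nat.eq_of_beq_eq_true h.1.1.1.1.1.1.1.1.2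
    have := congrArg (pc r) hij
    rw [hpc t ht, hpc t ht] at this
    rw [List.getD_eq_getElem _ _ (by omega), List.getD_eq_getElem _ _ (by omega),
      hn.getElem_inj_iff] at this
    exact Fin.ext this
  · rw [List.forall_mem_map]
    intro t ht e he
    have h := h1 t ht
    simp only [good, Bool.and_eq_true] at h
    have key : ∀ i j : Fin 8, adjN (t.getD i 0) (t.getD j 0) = true →
        s(pd r t i, pd r t j) ∈ (KK (Fin 8) (Fin r)).edgeSet := by
      intro i j hij
      rw [SimpleGraph.mem_edgeSet, ← adjN_iff, hpc t ht, hpc t ht]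
      exact hij
    simp only [E8, List.mem_cons, List.not_mem_nil, or_false] at he
    obtain ⟨⟨⟨⟨⟨⟨⟨⟨_, e1⟩, e2⟩, e3⟩, e4⟩, e5⟩, e6⟩, e7⟩, e8⟩ := h
    rcases he with rfl | rfl | rfl | rfl | rfl | rfl | rfl | rfl
    · exact key _ _ e1
    · exact key _ _ e2
    · exact key _ _ e3
    · exact key _ _ e4
    · exact key _ _ e5
    · exact key _ _ e6
    · exact key _ _ e7
    · exact key _ _ e8
  · intro u v huv hlt
    have hb : ∀ v, pc r v < 8 * r := by
      intro v
      have := v.1.2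
      have := v.2.2
      simp only [pc]
      omega
    have h := allLt_spec _ _ (allLt_spec _ _ h3 _ (hb u)) _ (hb v)
    rw [(adjN_iff r u v).2 huv] at h
    have h' : Nat.ble (pc r v) (pc r u) = false := by
      rw [Bool.eq_false_iff, ne_eq, Nat.ble_eq]
      omega
    rw [h', Bool.or_false, cond_true] at h
    rcases mask_spec _ _ _ h with h | h
    · simp at h
    · exact h

def dat2 : List (List ℕ) :=
  [[0, 1, 3, 7, 6, 4, 5, 15],
  [0, 2, 10, 8, 4, 7, 13, 12],
  [1, 2, 3, 6, 9, 5, 0, 7],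
  [4, 5, 13, 12, 2, 1, 14, 11],
  [4, 6, 5, 7, 3, 2, 0, 1],
  [8, 9, 14, 15, 11, 12, 6, 10],
  [9, 10, 11, 13, 15, 14, 3, 8],
  [11, 14, 12, 15, 9, 8, 10, 13]]

lemma kk8_2 : HasSunletDecomposition (KK (Fin 8) (Fin 2)) := by
  refine kk_check 2 (by norm_num) dat2 ?_ ?_ ?_
  · decide +kernel
  · decide +kernel
  · decide +kernel

def dat4 : List (List ℕ) :=
  [[3, 6, 5, 7, 0, 1, 2, 4],
  [1, 2, 3, 4, 0, 6, 5, 12],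
  [10, 11, 27, 26, 2, 3, 19, 18],
  [26, 30, 27, 31, 2, 6, 3, 7],
  [24, 29, 30, 31, 0, 5, 14, 15],
  [18, 20, 19, 23, 2, 4, 3, 7],
  [8, 14, 10, 15, 0, 6, 9, 7],
  [9, 13, 21, 17, 1, 5, 16, 18],
  [24, 26, 25, 30, 8, 29, 27, 28],
  [24, 25, 31, 28, 27, 1, 29, 4],
  [0, 2, 4, 6, 16, 7, 5, 22],
  [17, 20, 28, 25, 16, 22, 27, 29],
  [8, 9, 12, 11, 10, 14, 20, 13],
  [9, 11, 14, 15, 25, 19, 22, 23],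
  [16, 19, 17, 22, 8, 18, 1, 30],
  [20, 21, 22, 23, 16, 29, 19, 31],
  [12, 13, 29, 28, 14, 8, 27, 26],
  [0, 5, 1, 7, 4, 21, 3, 6],
  [10, 12, 15, 13, 18, 8, 11, 14],
  [16, 18, 21, 23, 24, 22, 19, 17]]

lemma kk8_4 : HasSunletDecomposition (KK (Fin 8) (Fin 4)) := by
  refine kk_check 4 (by norm_num) dat4 ?_ ?_ ?_
  · decide +kernel
  · decide +kernel
  · decide +kernel

def dat6 : List (List ℕ) :=
  [[1, 2, 5, 3, 0, 18, 6, 4],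
  [9, 10, 13, 11, 8, 2, 14, 12],
  [17, 18, 21, 19, 16, 10, 22, 20],
  [26, 29, 28, 31, 24, 30, 27, 47],
  [34, 37, 36, 39, 32, 38, 35, 31],
  [42, 45, 44, 47, 40, 46, 43, 39],
  [25, 28, 26, 30, 1, 12, 10, 46],
  [33, 36, 34, 38, 9, 20, 18, 30],
  [41, 44, 42, 46, 17, 4, 2, 38],
  [0, 2, 4, 6, 32, 26, 1, 30],
  [8, 10, 12, 14, 40, 34, 9, 38],
  [16, 18, 20, 22, 24, 42, 17, 46],
  [1, 9, 25, 33, 5, 15, 31, 37],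
  [9, 17, 33, 41, 13, 23, 39, 45],
  [17, 1, 41, 25, 21, 7, 47, 29],
  [24, 25, 27, 29, 8, 26, 35, 45],
  [32, 33, 35, 37, 16, 34, 43, 29],
  [40, 41, 43, 45, 0, 42, 27, 37],
  [3, 6, 46, 43, 19, 22, 44, 47],
  [11, 14, 30, 27, 3, 6, 28, 31],
  [19, 22, 38, 35, 11, 14, 36, 39],
  [0, 4, 28, 24, 3, 36, 44, 40],
  [8, 12, 36, 32, 11, 44, 28, 24],
  [16, 20, 44, 40, 19, 28, 36, 32],
  [2, 3, 35, 34, 6, 27, 32, 42],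
  [10, 11, 43, 42, 14, 35, 40, 26],
  [18, 19, 27, 26, 22, 43, 24, 34],
  [0, 5, 4, 7, 16, 21, 20, 2],
  [8, 13, 12, 15, 0, 5, 4, 10],
  [16, 21, 20, 23, 8, 13, 12, 18],
  [6, 7, 39, 38, 1, 3, 15, 32],
  [14, 15, 47, 46, 9, 11, 23, 40],
  [22, 23, 31, 30, 17, 19, 7, 24],
  [5, 7, 47, 45, 29, 23, 40, 13],
  [13, 15, 31, 29, 37, 7, 24, 21],
  [21, 23, 39, 37, 45, 15, 32, 5]]

lemma kk8_6 : HasSunletDecomposition (KK (Fin 8) (Fin 6)) := by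
  refine kk_check 6 (by norm_num) dat6 ?_ ?_ ?_
  · decide +kernel
  · decide +kernel
  · decide +kernel

def dat10 : List (List ℕ) :=
  [[1, 4, 6, 7, 0, 2, 22, 5],
  [9, 12, 14, 15, 8, 10, 30, 13],
  [17, 20, 22, 23, 16, 18, 38, 21],
  [25, 28, 30, 31, 24, 26, 6, 29],
  [33, 36, 38, 39, 32, 34, 14, 37],
  [42, 43, 47, 45, 2, 59, 7, 5],
  [50, 51, 55, 53, 10, 67, 15, 13],
  [58, 59, 63, 61, 18, 75, 23, 21],
  [66, 67, 71, 69, 26, 43, 31, 29],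
  [74, 75, 79, 77, 34, 51, 39, 37],
  [2, 58, 74, 66, 0, 26, 72, 18],
  [10, 66, 42, 74, 8, 34, 40, 26],
  [18, 74, 50, 42, 16, 2, 48, 34],
  [26, 42, 58, 50, 24, 10, 56, 2],
  [34, 50, 66, 58, 32, 18, 64, 10],
  [40, 41, 46, 47, 0, 65, 78, 79],
  [48, 49, 54, 55, 8, 73, 46, 47],
  [56, 57, 62, 63, 16, 41, 54, 55],
  [64, 65, 70, 71, 24, 49, 62, 63],
  [72, 73, 78, 79, 32, 57, 70, 71],
  [7, 15, 31, 63, 55, 11, 28, 79],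
  [15, 23, 39, 71, 63, 19, 36, 47],
  [23, 31, 7, 79, 71, 27, 4, 55],
  [31, 39, 15, 47, 79, 35, 12, 63],
  [39, 7, 23, 55, 47, 3, 20, 71],
  [0, 48, 40, 64, 8, 53, 24, 32],
  [8, 56, 48, 72, 16, 61, 32, 0],
  [16, 64, 56, 40, 24, 69, 0, 8],
  [24, 72, 64, 48, 32, 77, 8, 16],
  [32, 40, 72, 56, 0, 45, 16, 24],
  [41, 42, 46, 44, 9, 47, 14, 45],
  [49, 50, 54, 52, 17, 55, 22, 53],
  [57, 58, 62, 60, 25, 63, 30, 61],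
  [65, 66, 70, 68, 33, 71, 38, 69],
  [73, 74, 78, 76, 1, 79, 6, 77],
  [5, 21, 45, 53, 0, 13, 69, 51],
  [13, 29, 53, 61, 8, 21, 77, 59],
  [21, 37, 61, 69, 16, 29, 45, 67],
  [29, 5, 69, 77, 24, 37, 53, 75],
  [37, 13, 77, 45, 32, 5, 61, 43],
  [6, 14, 78, 62, 0, 13, 30, 22],
  [14, 22, 46, 70, 8, 21, 38, 30],
  [22, 30, 54, 78, 16, 29, 6, 38],
  [30, 38, 62, 46, 24, 37, 14, 6],
  [38, 6, 70, 54, 32, 5, 22, 14],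
  [4, 52, 44, 60, 76, 48, 42, 59],
  [12, 60, 52, 68, 44, 56, 50, 67],
  [20, 68, 60, 76, 52, 64, 58, 75],
  [28, 76, 68, 44, 60, 72, 66, 43],
  [36, 44, 76, 52, 68, 40, 74, 51],
  [3, 11, 27, 51, 59, 43, 67, 48],
  [11, 19, 35, 59, 67, 51, 75, 56],
  [19, 27, 3, 67, 75, 59, 43, 64],
  [27, 35, 11, 75, 43, 67, 51, 72],
  [35, 3, 19, 43, 51, 75, 59, 40],
  [0, 3, 2, 7, 16, 5, 26, 71],
  [8, 11, 10, 15, 24, 13, 34, 79],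
  [16, 19, 18, 23, 32, 21, 2, 47],
  [24, 27, 26, 31, 0, 29, 10, 55],
  [32, 35, 34, 39, 8, 37, 18, 63],
  [1, 17, 65, 57, 3, 18, 71, 33],
  [9, 25, 73, 65, 11, 26, 79, 1],
  [17, 33, 41, 73, 19, 34, 47, 9],
  [25, 1, 49, 41, 27, 2, 55, 17],
  [33, 9, 57, 49, 35, 10, 63, 25],
  [1, 5, 2, 6, 33, 77, 34, 3],
  [9, 13, 10, 14, 1, 45, 2, 11],
  [17, 21, 18, 22, 9, 53, 10, 19],
  [25, 29, 26, 30, 17, 61, 18, 27],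
  [33, 37, 34, 38, 25, 69, 26, 35],
  [41, 43, 46, 45, 1, 51, 40, 29],
  [49, 51, 54, 53, 9, 59, 48, 37],
  [57, 59, 62, 61, 17, 67, 56, 5],
  [65, 67, 70, 69, 25, 75, 64, 13],
  [73, 75, 78, 77, 33, 43, 72, 21],
  [4, 12, 28, 68, 5, 11, 24, 71],
  [12, 20, 36, 76, 13, 19, 32, 79],
  [20, 28, 4, 44, 21, 27, 0, 47],
  [28, 36, 12, 52, 29, 35, 8, 55],
  [36, 4, 20, 60, 37, 3, 16, 63]]

lemma kk8_10 : HasSunletDecomposition (KK (Fin 8) (Fin 10)) := by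
  refine kk_check 10 (by norm_num) dat10 ?_ ?_ ?_
  · decide +kernel
  · decide +kernel
  · decide +kernel

def bd (a : ℕ) [NeZero a] (t : List ℕ) (i : Fin 8) : Fin a ⊕ Fin 8 :=
  if t.getD i 0 < a then .inl (Fin.ofNat a (t.getD i 0)) else .inr (Fin.ofNat 8 (t.getD i 0 - a))

instance (U W : Type*) : DecidableRel (completeBipartiteGraph U W).Adj := fun a b => by
  unfold completeBipartiteGraph
  dsimp only
  infer_instance

def datb4 : List (List ℕ) :=
  [[0, 4, 1, 5, 6, 2, 7, 3],
  [0, 7, 2, 8, 9, 3, 5, 1],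
  [1, 9, 3, 11, 10, 2, 8, 0],
  [2, 6, 3, 10, 11, 1, 4, 0]]

lemma bip4_8 : HasSunletDecomposition (completeBipartiteGraph (Fin 4) (Fin 8)) := by
  refine hsd_list _ (datb4.map (bd 4)) ?_ ?_ ?_ ?_
  · rw [List.forall_mem_map]
    decide +kernel
  · rw [List.forall_mem_map]
    decide +kernel
  · decide +kernel
  · decide +kernel

def datb6 : List (List ℕ) :=
  [[0, 8, 1, 12, 6, 2, 7, 3],
  [4, 9, 5, 10, 6, 0, 7, 1],
  [0, 11, 3, 13, 7, 2, 9, 5],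
  [2, 12, 4, 13, 6, 5, 8, 1],
  [2, 7, 3, 10, 9, 4, 8, 0],
  [1, 6, 5, 11, 9, 3, 8, 4]]

lemma bip6_8 : HasSunletDecomposition (completeBipartiteGraph (Fin 6) (Fin 8)) := by
  refine hsd_list _ (datb6.map (bd 6)) ?_ ?_ ?_ ?_
  · rw [List.forall_mem_map]
    decide +kernel
  · rw [List.forall_mem_map]
    decide +kernel
  · decide +kernel
  · decide +kernel

lemma bip4_4 : HasSunletDecomposition (completeBipartiteGraph (Fin 4) (Fin 4)) := by
  refine hsd_list _ ([[0, 4, 1, 5, 6, 2, 7, 3], [2, 6, 3, 7, 5, 1, 4, 0]].map fun t i =>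
    if t.getD i 0 < 4 then .inl (Fin.ofNat 4 (t.getD i 0))
    else .inr (Fin.ofNat 4 (t.getD i 0 - 4))) ?_ ?_ ?_ ?_
  · rw [List.forall_mem_map]
    decide +kernel
  · rw [List.forall_mem_map]
    decide +kernel
  · decide +kernel
  · decide +kernel

lemma bip8_8 : HasSunletDecomposition (completeBipartiteGraph (Fin 8) (Fin 8)) :=
  bip_congr finSumFinEquiv (Equiv.refl _) (bip_sum bip4_8 bip4_8)

lemma bip10_8 : HasSunletDecomposition (completeBipartiteGraph (Fin 10) (Fin 8)) :=
  bip_congr (finSumFinEquiv (m := 4) (n := 6)) (Equiv.refl _) (bip_sum bip4_8 bip6_8)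

lemma kk8_8 : HasSunletDecomposition (KK (Fin 8) (Fin 8)) :=
  kk_congr (finSumFinEquiv (m := 4) (n := 4)) (Equiv.refl _)
    (kk_sum (kk_comm kk8_4) (kk_comm kk8_4) bip4_4)

lemma step (W : Type*) (n : ℕ) (h8 : HasSunletDecomposition (KK (Fin 8) W))
    (h1 : HasSunletDecomposition (KK (Fin n) W))
    (h2 : HasSunletDecomposition (completeBipartiteGraph (Fin n) (Fin 8))) (q : ℕ) :
    HasSunletDecomposition (KK (Fin (n + 8 * q)) W) ∧
    HasSunletDecomposition (completeBipartiteGraph (Fin (n + 8 * q)) (Fin 8)) := by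
  induction q with
  | zero => exact ⟨h1, h2⟩
  | succ q ih =>
    exact ⟨kk_congr (finSumFinEquiv (m := n + 8 * q) (n := 8)) (Equiv.refl _)
      (kk_sum ih.1 h8 ih.2),
      bip_congr (finSumFinEquiv (m := n + 8 * q) (n := 8)) (Equiv.refl _)
      (bip_sum ih.2 bip8_8)⟩

lemma kk8_even (n : ℕ) (hn : 0 < n) (h2 : n % 2 = 0) :
    HasSunletDecomposition (KK (Fin 8) (Fin n)) := by
  have : n = 2 ∨ n = 4 + 8 * ((n - 4) / 8) ∨ n = 6 + 8 * ((n - 4) / 8) ∨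
    n = 8 + 8 * ((n - 4) / 8) ∨ n = 10 + 8 * ((n - 4) / 8) := by omega
  generalize (n - 4) / 8 = q at this
  rcases this with rfl | rfl | rfl | rfl | rfl
  · exact kk8_2
  · exact kk_comm (step _ 4 kk8_8 (kk_comm kk8_4) bip4_8 q).1
  · exact kk_comm (step _ 6 kk8_8 (kk_comm kk8_6) bip6_8 q).1
  · exact kk_comm (step _ 8 kk8_8 (kk_comm kk8_8) bip8_8 q).1
  · exact kk_comm (step _ 10 kk8_8 (kk_comm kk8_10) bip10_8 q).1

theorem stmt_2 (m n : ℕ) (hm : 0 < m) (hn : 0 < n) (h1 : m % 8 = 0) (h2 : n % 2 = 0) :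
    HasSunletDecomposition ((⊤ : SimpleGraph (Fin m)) □ (⊤ : SimpleGraph (Fin n))) := by
  have : m = 8 + 8 * ((m - 8) / 8) := by omega
  generalize (m - 8) / 8 = q at this
  subst this
  exact (step _ 8 (kk8_even n hn h2) (kk8_even n hn h2) bip8_8 q).1
end

section
/- If m and n are positive integers with m ≡ 15 (mod 16) and n ≡ 3 (mod 16), then the graph K_m □ K_n has an L_8-decomposition. -/
open SimpleGraph

def slS : Fin 8 → Fin 8 := ![0,1,2,3,0,1,2,3]
def slT : Fin 8 → Fin 8 := ![1,2,3,0,4,5,6,7]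

lemma sunlet8_edgeSet : sunlet8.edgeSet = Set.range (fun j => s(slS j, slT j)) := by
  ext e
  induction e using Sym2.ind with
  | _ a b =>
    simp only [mem_edgeSet, sunlet8, SimpleGraph.fromRel_adj, Set.mem_range, Sym2.eq_iff]
    revert a b
    decide

lemma decomp_of_cayley {V I : Type*} [AddCommGroup V] (G : SimpleGraph V)
    (f : I → Fin 8 → V) (D : I → Fin 8 → V)
    (hD : ∀ i j, D i j = f i (slT j) - f i (slS j))
    (hf : ∀ i, Function.Injective (f i))
    (hG : ∀ x y, G.Adj x y ↔ ∃ i j, y - x = D i j ∨ y - x = - D i j)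
    (hinj : ∀ i j i' j', D i j = D i' j' → i = i' ∧ j = j')
    (hneg : ∀ i j i' j', D i j ≠ - D i' j') : HasSunletDecomposition G := by
  refine ⟨Set.range (fun p : I × V => Sym2.map (fun a => f p.1 a + p.2) '' sunlet8.edgeSet),
    ?_, ?_, ?_⟩
  · ext e
    induction e using Sym2.ind with
    | _ x y =>
      simp only [Set.sUnion_range, Set.mem_iUnion, sunlet8_edgeSet, mem_edgeSet, hG,
        Set.mem_image, Set.mem_range, exists_exists_eq_and, Sym2.map_mk, Sym2.eq_iff]
      constructor
      · rintro ⟨⟨i, v⟩, j, ⟨rfl, rfl⟩ | ⟨rfl, rfl⟩⟩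
        · exact ⟨i, j, Or.inl (by rw [hD]; abel)⟩
        · exact ⟨i, j, Or.inr (by rw [hD]; abel)⟩
      · rintro ⟨i, j, h | h⟩
        · refine ⟨(i, x - f i (slS j)), j, Or.inl ⟨by simp, ?_⟩⟩
          rw [hD, sub_eq_iff_eq_add] at h
          rw [h]; abel
        · refine ⟨(i, y - f i (slS j)), j, Or.inr ⟨by simp, ?_⟩⟩
          rw [hD, sub_eq_iff_eq_add] at h
          subst h
          simp only
          abel
  · rintro _ ⟨⟨i, v⟩, rfl⟩ _ ⟨⟨i', v'⟩, rfl⟩ hne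
    simp only [Function.onFun, id]
    rw [Set.disjoint_left]
    intro e he he'
    apply hne
    simp only [sunlet8_edgeSet, Set.mem_image, Set.mem_range, exists_exists_eq_and,
      Sym2.map_mk] at he he'
    obtain ⟨j, rfl⟩ := he
    obtain ⟨j', h⟩ := he'
    rw [Sym2.eq_iff] at h
    rcases h with ⟨h1, h2⟩ | ⟨h1, h2⟩
    · have : D i' j' = D i j := by
        rw [hD, hD]
        have : f i' (slT j') - f i' (slS j') = (f i' (slT j') + v') - (f i' (slS j') + v') := by abel
        rw [this, h1, h2]; abel
      obtain ⟨rfl, rfl⟩ := hinj _ _ _ _ this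
      have : v' = v := by simpa using h1
      rw [this]
    · exfalso
      apply hneg i' j' i j
      rw [hD, hD]
      have : f i' (slT j') - f i' (slS j') = (f i' (slT j') + v') - (f i' (slS j') + v') := by abel
      rw [this, h1, h2]; abel
  · rintro _ ⟨⟨i, v⟩, rfl⟩
    exact ⟨_, fun a b h => hf i (by simpa using h), rfl⟩

/-- generic block with differences `d, ..., d+7` -/
def blk (d : ℤ) : Fin 8 → ℤ := ![0, d, -1, -d-3, d+6, -7, d+4, 1]
def sg : Fin 8 → ℤ := ![1,-1,-1,1,1,-1,1,1]
def sig : Fin 8 → ℤ := ![0,1,2,3,6,7,5,4]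

lemma blk_diff (d : ℤ) (j : Fin 8) :
    blk d (slT j) - blk d (slS j) = sg j * (d + sig j) := by
  fin_cases j <;> simp [blk, slT, slS, sg, sig] <;> ring

lemma sg_cases (j : Fin 8) : sg j = 1 ∨ sg j = -1 := by revert j; decide
lemma sig_bd (j : Fin 8) : 0 ≤ sig j ∧ sig j < 8 := by revert j; decide
lemma sig_inj : ∀ j j' : Fin 8, sig j = sig j' → j = j' := by decide
lemma sig_surj (z : ℤ) (h : 0 ≤ z) (h' : z < 8) : ∃ j, sig j = z := by
  interval_cases z <;> decide

lemma cast_small {N : ℕ} {x y : ℤ} (h : ((x : ℤ) : ZMod N) = y) (h1 : x - y < N) (h2 : y - x < N) :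
    x = y := by
  rw [ZMod.intCast_eq_intCast_iff_dvd_sub] at h
  have := Int.eq_zero_of_abs_lt_dvd h (by rw [abs_lt]; constructor <;> linarith)
  linarith

lemma blk_inj {N : ℕ} (d : ℤ) (hd : d = 2 ∨ 5 ≤ d) (hN : 2 * d + 15 ≤ N) :
    Function.Injective (fun a => ((blk d a : ℤ) : ZMod N)) := by
  intro a b h
  have hb : ∀ a b, blk d a - blk d b < N := by
    intro a b
    fin_cases a <;> fin_cases b <;> simp [blk] <;> omega
  have := cast_small h (hb _ _) (hb _ _)
  revert this
  clear h hb
  fin_cases a <;> fin_cases b <;> simp [blk] <;> omega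

/-- mixed block -/
def mx1 : Fin 8 → ℤ := ![0, 1, -1, -4, 5, 7, 6, -4]
def mx2 : Fin 8 → ℤ := ![0, 0, 0, 0, 0, 0, 0, 1]
def md1 : Fin 8 → ℤ := ![1, -2, -3, 4, 5, 6, 7, 0]

def F1 (a b : ℕ) : Unit ⊕ Fin a ⊕ Fin b → Fin 8 → ℤ
  | .inl _ => mx1
  | .inr (.inl k) => blk (8 * (k : ℕ) + 8)
  | .inr (.inr _) => 0
def F2 (a b : ℕ) : Unit ⊕ Fin a ⊕ Fin b → Fin 8 → ℤ
  | .inl _ => mx2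
  | .inr (.inl _) => 0
  | .inr (.inr k) => blk (8 * (k : ℕ) + 2)
def D1 (a b : ℕ) : Unit ⊕ Fin a ⊕ Fin b → Fin 8 → ℤ
  | .inl _ => md1
  | .inr (.inl k) => fun j => sg j * (8 * (k : ℕ) + 8 + sig j)
  | .inr (.inr _) => 0
def D2 (a b : ℕ) : Unit ⊕ Fin a ⊕ Fin b → Fin 8 → ℤ
  | .inl _ => mx2
  | .inr (.inl _) => 0
  | .inr (.inr k) => fun j => sg j * (8 * (k : ℕ) + 2 + sig j)

lemma D1_eq (a b i j) : D1 a b i j = F1 a b i (slT j) - F1 a b i (slS j) := by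
  rcases i with i | i | i
  · revert j; show ∀ j, md1 j = mx1 (slT j) - mx1 (slS j); decide
  · exact (blk_diff _ _).symm
  · rfl
lemma D2_eq (a b i j) : D2 a b i j = F2 a b i (slT j) - F2 a b i (slS j) := by
  rcases i with i | i | i
  · revert j; show ∀ j, mx2 j = mx2 (slT j) - mx2 (slS j); decide
  · rfl
  · exact (blk_diff _ _).symm

/-- explicit description of the differences -/
lemma md_bd : ∀ j, -7 ≤ md1 j ∧ md1 j ≤ 7 ∧ 0 ≤ mx2 j ∧ mx2 j ≤ 1 ∧ (md1 j = 0 ↔ mx2 j = 1) := by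
  decide
lemma md_inj : ∀ j j', (md1 j = md1 j' ∨ md1 j = - md1 j') → j = j' := by decide
lemma md_neg : ∀ j j', ¬ (md1 j = - md1 j' ∧ mx2 j = - mx2 j') := by decide
lemma md_surj (z : ℤ) (h : 1 ≤ z) (h' : z ≤ 7) : ∃ j, (md1 j = z ∨ md1 j = -z) ∧ mx2 j = 0 := by
  interval_cases z <;> decide

lemma D_bd (a b i j) : |D1 a b i j| ≤ 8 * a + 7 ∧ |D2 a b i j| ≤ 8 * b + 1 ∧
    (D1 a b i j = 0 ↔ D2 a b i j ≠ 0) := by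
  rcases i with i | i | i
  · have := md_bd j
    simp only [D1, D2, abs_le]
    omega
  · have := sig_bd j
    have := i.2
    simp only [D1, D2, abs_le, Pi.zero_apply]
    rcases sg_cases j with h | h <;> rw [h] <;> omega
  · have := sig_bd j
    have := i.2
    simp only [D1, D2, abs_le, Pi.zero_apply]
    rcases sg_cases j with h | h <;> rw [h] <;>
      exact ⟨by omega, by omega, fun _ => by omega, fun _ => trivial⟩

lemma D_inj (a b i j i' j') (h : D1 a b i j = D1 a b i' j' ∧ D2 a b i j = D2 a b i' j' ∨
    D1 a b i j = - D1 a b i' j' ∧ D2 a b i j = - D2 a b i' j') : i = i' ∧ j = j' := by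
  have s1 := sig_bd j
  have s2 := sig_bd j'
  have s3 := md_bd j
  have s4 := md_bd j'
  have g1 := sg_cases j
  have g2 := sg_cases j'
  have hs := sig_inj j j'
  rcases i with i | i | i <;> rcases i' with i' | i' | i' <;> simp only [D1, D2, Pi.zero_apply] at h
  · exact ⟨rfl, md_inj _ _ (by omega)⟩
  · exfalso; rcases g2 with g | g <;> rw [g] at h <;> omega
  · exfalso; rcases g2 with g | g <;> rw [g] at h <;> omega
  · exfalso; rcases g1 with g | g <;> rw [g] at h <;> omega
  · have : (i : ℕ) = i' ∧ sig j = sig j' := by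
      rcases g1 with g | g <;> rcases g2 with g' | g' <;> rw [g, g'] at h <;> omega
    exact ⟨by rw [Fin.ext this.1], hs this.2⟩
  · exfalso; rcases g1 with g | g <;> rcases g2 with g' | g' <;> rw [g, g'] at h <;> omega
  · exfalso; rcases g1 with g | g <;> rw [g] at h <;> omega
  · exfalso; rcases g1 with g | g <;> rcases g2 with g' | g' <;> rw [g, g'] at h <;> omega
  · have : (i : ℕ) = i' ∧ sig j = sig j' := by
      rcases g1 with g | g <;> rcases g2 with g' | g' <;> rw [g, g'] at h <;> omega
    exact ⟨by rw [Fin.ext this.1], hs this.2⟩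

lemma surj1 (a b : ℕ) (z : ℤ) (h0 : z ≠ 0) (h : |z| ≤ 8 * a + 7) :
    ∃ i j, (D1 a b i j = z ∨ D1 a b i j = -z) ∧ D2 a b i j = 0 := by
  have h1 : 1 ≤ |z| := Int.one_le_abs h0
  by_cases h7 : |z| ≤ 7
  · obtain ⟨j, hj, hj'⟩ := md_surj |z| h1 h7
    refine ⟨.inl (), j, ?_, hj'⟩
    simp only [D1]
    rcases abs_choice z with e | e <;> rw [e] at hj <;> omega
  · obtain ⟨j, hj⟩ := sig_surj (|z| % 8) (by omega) (by omega)
    refine ⟨.inr (.inl ⟨(|z| / 8 - 1).toNat, by omega⟩), j, ?_, rfl⟩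
    simp only [D1, hj]
    rcases abs_choice z with e | e <;> rcases sg_cases j with g | g <;> rw [g] <;> omega

lemma surj2 (a b : ℕ) (z : ℤ) (h0 : z ≠ 0) (h : |z| ≤ 8 * b + 1) :
    ∃ i j, (D2 a b i j = z ∨ D2 a b i j = -z) ∧ D1 a b i j = 0 := by
  have h1 : 1 ≤ |z| := Int.one_le_abs h0
  by_cases h7 : |z| ≤ 1
  · refine ⟨.inl (), 7, ?_, rfl⟩
    have : D2 a b (.inl ()) 7 = 1 := rfl
    rw [this]
    rcases abs_choice z with e | e <;> omega
  · obtain ⟨j, hj⟩ := sig_surj ((|z| - 2) % 8) (by omega) (by omega)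
    refine ⟨.inr (.inr ⟨((|z| - 2) / 8).toNat, by omega⟩), j, ?_, rfl⟩
    simp only [D2, hj]
    rcases abs_choice z with e | e <;> rcases sg_cases j with g | g <;> rw [g] <;> omega

lemma exists_small (M : ℕ) (x : ZMod (2 * M + 1)) : ∃ z : ℤ, |z| ≤ M ∧ (z : ZMod (2 * M + 1)) = x := by
  refine ⟨x.valMinAbs, ?_, x.coe_valMinAbs⟩
  have := x.natAbs_valMinAbs_le
  rw [Int.abs_eq_natAbs]
  omega

lemma main_zmod (a b : ℕ) : HasSunletDecomposition
    ((⊤ : SimpleGraph (ZMod (2 * (8 * a + 7) + 1))) □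
      (⊤ : SimpleGraph (ZMod (2 * (8 * b + 1) + 1)))) := by
  have key1 : ∀ i j i' j', ((D1 a b i j : ℤ) : ZMod (2 * (8 * a + 7) + 1)) = (D1 a b i' j' : ℤ) →
      D1 a b i j = D1 a b i' j' := by
    intro i j i' j' h
    have h1 := abs_le.1 (D_bd a b i j).1
    have h2 := abs_le.1 (D_bd a b i' j').1
    exact cast_small h (by push_cast; omega) (by push_cast; omega)
  have key1' : ∀ i j i' j', ((D1 a b i j : ℤ) : ZMod (2 * (8 * a + 7) + 1)) = (-D1 a b i' j' : ℤ) →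
      D1 a b i j = -D1 a b i' j' := by
    intro i j i' j' h
    have h1 := abs_le.1 (D_bd a b i j).1
    have h2 := abs_le.1 (D_bd a b i' j').1
    exact cast_small h (by push_cast; omega) (by push_cast; omega)
  have key2 : ∀ i j i' j', ((D2 a b i j : ℤ) : ZMod (2 * (8 * b + 1) + 1)) = (D2 a b i' j' : ℤ) →
      D2 a b i j = D2 a b i' j' := by
    intro i j i' j' h
    have h1 := abs_le.1 (D_bd a b i j).2.1
    have h2 := abs_le.1 (D_bd a b i' j').2.1
    exact cast_small h (by push_cast; omega) (by push_cast; omega)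
  have key2' : ∀ i j i' j', ((D2 a b i j : ℤ) : ZMod (2 * (8 * b + 1) + 1)) = (-D2 a b i' j' : ℤ) →
      D2 a b i j = -D2 a b i' j' := by
    intro i j i' j' h
    have h1 := abs_le.1 (D_bd a b i j).2.1
    have h2 := abs_le.1 (D_bd a b i' j').2.1
    exact cast_small h (by push_cast; omega) (by push_cast; omega)
  have z1 : ∀ i j, ((D1 a b i j : ℤ) : ZMod (2 * (8 * a + 7) + 1)) = 0 → D1 a b i j = 0 := by
    intro i j h
    have h1 := abs_le.1 (D_bd a b i j).1
    exact cast_small (y := 0) (by simpa using h) (by push_cast; omega) (by push_cast; omega)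
  have z2 : ∀ i j, ((D2 a b i j : ℤ) : ZMod (2 * (8 * b + 1) + 1)) = 0 → D2 a b i j = 0 := by
    intro i j h
    have h1 := abs_le.1 (D_bd a b i j).2.1
    exact cast_small (y := 0) (by simpa using h) (by push_cast; omega) (by push_cast; omega)
  refine decomp_of_cayley _
    (fun i j => (((F1 a b i j : ℤ) : ZMod (2 * (8 * a + 7) + 1)),
      ((F2 a b i j : ℤ) : ZMod (2 * (8 * b + 1) + 1))))
    (fun i j => (((D1 a b i j : ℤ) : ZMod (2 * (8 * a + 7) + 1)),
      ((D2 a b i j : ℤ) : ZMod (2 * (8 * b + 1) + 1)))) ?_ ?_ ?_ ?_ ?_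
  · intro i j
    simp [D1_eq, D2_eq]
  · intro i x y h
    rw [Prod.mk.injEq] at h
    obtain ⟨h1, h2⟩ := h
    rcases i with i | i | i
    · simp only [F1, F2] at h1 h2
      have hb : ∀ j, -4 ≤ mx1 j ∧ mx1 j ≤ 7 ∧ 0 ≤ mx2 j ∧ mx2 j ≤ 1 := by decide
      have hx := hb x
      have hy := hb y
      have e1 := cast_small h1 (by push_cast; omega) (by push_cast; omega)
      have e2 := cast_small h2 (by push_cast; omega) (by push_cast; omega)
      have : ∀ x y, mx1 x = mx1 y ∧ mx2 x = mx2 y → x = y := by decide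
      exact this _ _ ⟨e1, e2⟩
    · have := i.2
      exact blk_inj (8 * (i : ℕ) + 8) (by omega) (by push_cast; omega) h1
    · have := i.2
      exact blk_inj (8 * (i : ℕ) + 2) (by omega) (by push_cast; omega) h2
  · rintro ⟨x1, x2⟩ ⟨y1, y2⟩
    simp only [SimpleGraph.boxProd_adj, SimpleGraph.top_adj, Prod.mk_sub_mk, Prod.neg_mk,
      Prod.mk.injEq]
    constructor
    · rintro (⟨hx, rfl⟩ | ⟨hx, rfl⟩)
      · obtain ⟨z, hz, hz'⟩ := exists_small _ (y1 - x1)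
        have h0 : z ≠ 0 := by
          rintro rfl
          apply hx
          rw [Int.cast_zero] at hz'
          exact (sub_eq_zero.1 hz'.symm).symm
        obtain ⟨i, j, h, h'⟩ := surj1 a b z h0 (by push_cast at hz; exact hz)
        refine ⟨i, j, ?_⟩
        rcases h with h | h <;> simp [h, h', ← hz']
      · obtain ⟨z, hz, hz'⟩ := exists_small _ (y2 - x2)
        have h0 : z ≠ 0 := by
          rintro rfl
          apply hx
          rw [Int.cast_zero] at hz'
          exact (sub_eq_zero.1 hz'.symm).symm
        obtain ⟨i, j, h, h'⟩ := surj2 a b z h0 (by push_cast at hz; exact hz)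
        refine ⟨i, j, ?_⟩
        rcases h with h | h <;> simp [h, h', ← hz']
    · rintro ⟨i, j, h⟩
      have hb := (D_bd a b i j).2.2
      have w1 := z1 i j
      have w2 := z2 i j
      by_cases h0 : D1 a b i j = 0
      · right
        have h2 := hb.1 h0
        rw [h0] at h
        have : y1 - x1 = 0 := by rcases h with h | h <;> simpa using h.1
        refine ⟨?_, (sub_eq_zero.1 this).symm⟩
        rintro rfl
        apply h2
        apply w2
        rcases h with h | h
        · simpa using h.2.symm
        · simpa using h.2.symm
      · left
        have h2 : D2 a b i j = 0 := by tauto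
        rw [h2] at h
        have : y2 - x2 = 0 := by rcases h with h | h <;> simpa using h.2
        refine ⟨?_, (sub_eq_zero.1 this).symm⟩
        rintro rfl
        apply h0
        apply w1
        rcases h with h | h
        · simpa using h.1.symm
        · simpa using h.1.symm
  · intro i j i' j' h
    rw [Prod.mk.injEq] at h
    exact D_inj a b i j i' j' (Or.inl ⟨key1 _ _ _ _ h.1, key2 _ _ _ _ h.2⟩)
  · intro i j i' j' h
    rw [Prod.neg_mk, Prod.mk.injEq] at h
    have e1 := key1' i j i' j' (by rw [h.1]; simp)
    have e2 := key2' i j i' j' (by rw [h.2]; simp)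
    obtain ⟨rfl, rfl⟩ := D_inj a b i j i' j' (Or.inr ⟨e1, e2⟩)
    have := (D_bd a b i j).2.2
    omega

theorem stmt_5 (m n : ℕ) (hm : 0 < m) (hn : 0 < n) (h1 : m % 16 = 15) (h2 : n % 16 = 3) :
    HasSunletDecomposition ((⊤ : SimpleGraph (Fin m)) □ (⊤ : SimpleGraph (Fin n))) := by
  obtain ⟨a, rfl⟩ : ∃ a, m = 2 * (8 * a + 7) + 1 := ⟨m / 16, by omega⟩
  obtain ⟨b, rfl⟩ : ∃ b, n = 2 * (8 * b + 1) + 1 := ⟨n / 16, by omega⟩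
  exact main_zmod a b
end

section
/- The graph K_16 □ K_5 has an L_8-decomposition. -/
open SimpleGraph

/-- first coordinates of the base sunlets (rows of 8) -/
def slTab : List (List ℕ) := [
  [0, 2, 1, 3, 0, 2, 1, 3], 
  [2, 4, 3, 5, 2, 4, 3, 5], 
  [4, 6, 5, 7, 4, 6, 5, 7], 
  [6, 8, 7, 9, 6, 8, 7, 9], 
  [8, 10, 9, 11, 8, 10, 9, 11], 
  [10, 12, 11, 13, 10, 12, 11, 13], 
  [12, 14, 13, 15, 12, 14, 13, 15], 
  [14, 0, 15, 1, 14, 0, 15, 1], 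
  [1, 9, 12, 5, 7, 4, 2, 8], 
  [3, 15, 11, 6, 8, 5, 4, 1], 
  [3, 7, 6, 12, 13, 14, 2, 1], 
  [2, 10, 4, 13, 11, 3, 12, 8], 
  [8, 9, 15, 14, 4, 0, 6, 3], 
  [2, 14, 10, 15, 9, 6, 1, 7], 
  [2, 7, 11, 3, 8, 13, 1, 9], 
  [0, 11, 14, 4, 7, 10, 5, 15], 
  [0, 1, 8, 12, 10, 4, 15, 7], 
  [0, 13, 9, 5, 8, 12, 14, 11], 
  [5, 13, 6, 10, 4, 1, 0, 7]]

/-- owner of a horizontal edge -/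
def slOwn : List (List ℕ) := [
  [0, 16, 0, 0, 15, 17, 18, 15, 17, 12, 16, 15, 16, 17, 7, 7], 
  [16, 0, 0, 0, 16, 8, 9, 8, 16, 8, 13, 14, 10, 18, 7, 7], 
  [0, 0, 0, 14, 1, 1, 10, 14, 14, 13, 11, 11, 8, 11, 13, 13], 
  [0, 0, 14, 0, 1, 1, 9, 10, 9, 14, 11, 14, 10, 10, 12, 9], 
  [15, 16, 1, 1, 0, 18, 2, 2, 12, 8, 11, 9, 11, 11, 15, 15], 
  [17, 8, 1, 1, 18, 0, 2, 2, 8, 17, 18, 17, 8, 18, 15, 9], 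
  [18, 9, 10, 9, 2, 2, 0, 10, 3, 3, 18, 9, 10, 18, 13, 12], 
  [15, 8, 14, 10, 2, 2, 10, 0, 3, 3, 18, 14, 16, 14, 10, 13], 
  [17, 16, 14, 9, 12, 8, 3, 3, 0, 12, 4, 4, 16, 11, 12, 16], 
  [12, 8, 13, 14, 8, 17, 3, 3, 12, 0, 4, 4, 8, 17, 17, 12], 
  [16, 13, 11, 11, 11, 18, 18, 18, 4, 4, 0, 15, 5, 5, 13, 13], 
  [15, 14, 11, 14, 9, 17, 9, 14, 4, 4, 15, 0, 5, 5, 15, 9], 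
  [16, 10, 8, 10, 11, 8, 10, 16, 16, 8, 5, 5, 0, 17, 6, 6], 
  [17, 18, 11, 10, 11, 18, 18, 14, 11, 17, 5, 5, 17, 0, 6, 6], 
  [7, 7, 13, 12, 15, 15, 13, 10, 12, 17, 13, 15, 6, 6, 0, 12], 
  [7, 7, 13, 9, 15, 9, 12, 13, 16, 12, 13, 9, 6, 6, 12, 0]]

def slShift (i a : ℕ) : ℕ :=
  if i < 8 then (if a < 4 then 0 else if a % 2 = 0 then 1 else 2) else 0

def slF (i : Fin 19) (j : Fin 5) (a : Fin 8) : Fin 16 × Fin 5 :=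
  (Fin.ofNat 16 ((slTab.getD i.val []).getD a.val 0), Fin.ofNat 5 (j.val + slShift i.val a.val))

def slOwner (x y : Fin 16 × Fin 5) : Fin 19 × Fin 5 :=
  match (y.2.val + 5 - x.2.val) % 5 with
  | 0 => (Fin.ofNat 19 ((slOwn.getD x.1.val []).getD y.1.val 0), x.2)
  | 1 => (Fin.ofNat 19 (x.1.val / 2), x.2)
  | 4 => (Fin.ofNat 19 (x.1.val / 2), y.2)
  | 2 => (Fin.ofNat 19 ((x.1.val / 2 + 7) % 8), x.2)
  | _ => (Fin.ofNat 19 ((x.1.val / 2 + 7) % 8), y.2)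

def slDarts : List (Fin 8 × Fin 8) :=
  [(0,1),(1,2),(2,3),(3,0),(0,4),(1,5),(2,6),(3,7),(1,0),(2,1),(3,2),(0,3),(4,0),(5,1),(6,2),(7,3)]

theorem sl_adj (a b : Fin 8) : sunlet8.Adj a b ↔ (a, b) ∈ slDarts := by
  unfold sunlet8
  rw [SimpleGraph.fromRel_adj]
  revert a b
  decide +kernel

theorem sl_inj : ∀ i j a b, slF i j a = slF i j b → a = b := by
  decide +kernel

theorem sl_own : ∀ i j, ∀ p ∈ slDarts, slOwner (slF i j p.1) (slF i j p.2) = (i, j) := by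
  decide +kernel

theorem sl_sub : ∀ i j, ∀ p ∈ slDarts,
    ((slF i j p.1).1 ≠ (slF i j p.2).1 ∧ (slF i j p.1).2 = (slF i j p.2).2) ∨
    ((slF i j p.1).2 ≠ (slF i j p.2).2 ∧ (slF i j p.1).1 = (slF i j p.2).1) := by
  decide +kernel

theorem sl_cov1 : ∀ (u v : Fin 16) (j : Fin 5), u ≠ v → ∃ p ∈ slDarts,
    slF (slOwner (u, j) (v, j)).1 (slOwner (u, j) (v, j)).2 p.1 = (u, j) ∧
    slF (slOwner (u, j) (v, j)).1 (slOwner (u, j) (v, j)).2 p.2 = (v, j) := by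
  decide +kernel

theorem sl_cov2 : ∀ (u : Fin 16) (j k : Fin 5), j ≠ k → ∃ p ∈ slDarts,
    slF (slOwner (u, j) (u, k)).1 (slOwner (u, j) (u, k)).2 p.1 = (u, j) ∧
    slF (slOwner (u, j) (u, k)).1 (slOwner (u, j) (u, k)).2 p.2 = (u, k) := by
  decide +kernel

def slSet (q : Fin 19 × Fin 5) : Set (Sym2 (Fin 16 × Fin 5)) :=
  Sym2.map (slF q.1 q.2) '' sunlet8.edgeSet

theorem sl_mem (q : Fin 19 × Fin 5) (x y : Fin 16 × Fin 5) :
    s(x, y) ∈ slSet q ↔ ∃ p ∈ slDarts, slF q.1 q.2 p.1 = x ∧ slF q.1 q.2 p.2 = y := by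
  constructor
  · rintro ⟨e, he, h⟩
    induction e using Sym2.ind with
    | _ a b =>
      rw [SimpleGraph.mem_edgeSet] at he
      rw [Sym2.map_mk] at h
      rcases Sym2.eq_iff.1 h with ⟨h1, h2⟩ | ⟨h1, h2⟩
      · exact ⟨(a, b), (sl_adj a b).1 he, h1, h2⟩
      · exact ⟨(b, a), (sl_adj b a).1 he.symm, h2, h1⟩
  · rintro ⟨⟨a, b⟩, hp, rfl, rfl⟩
    exact ⟨s(a, b), (sl_adj a b).2 hp, rfl⟩

theorem stmt_14 :
    HasSunletDecomposition ((⊤ : SimpleGraph (Fin 16)) □ (⊤ : SimpleGraph (Fin 5))) := by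
  refine ⟨Set.range slSet, ?_, ?_, ?_⟩
  · ext e
    induction e using Sym2.ind with
    | _ x y =>
      rw [Set.sUnion_range, Set.mem_iUnion, SimpleGraph.mem_edgeSet, SimpleGraph.boxProd_adj]
      simp only [SimpleGraph.top_adj]
      constructor
      · rintro ⟨q, hq⟩
        obtain ⟨p, hp, rfl, rfl⟩ := (sl_mem q x y).1 hq
        exact sl_sub q.1 q.2 p hp
      · obtain ⟨u, j⟩ := x
        obtain ⟨v, k⟩ := y
        rintro (⟨h, h'⟩ | ⟨h, h'⟩)
        · dsimp only at h h'
          subst h'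
          exact ⟨_, (sl_mem _ _ _).2 (sl_cov1 u v j h)⟩
        · dsimp only at h h'
          subst h'
          exact ⟨_, (sl_mem _ _ _).2 (sl_cov2 u j k h)⟩
  · rintro _ ⟨q, rfl⟩ _ ⟨r, rfl⟩ hne
    refine Set.disjoint_left.2 fun e he he' => hne ?_
    induction e using Sym2.ind with
    | _ x y =>
      obtain ⟨p, hp, h1, h2⟩ := (sl_mem q x y).1 he
      obtain ⟨p', hp', h1', h2'⟩ := (sl_mem r x y).1 he'
      have e1 := sl_own q.1 q.2 p hp
      have e2 := sl_own r.1 r.2 p' hp'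
      rw [h1, h2] at e1
      rw [h1', h2'] at e2
      have : q = r := e1.symm.trans e2
      rw [this]
  · rintro _ ⟨q, rfl⟩
    exact ⟨slF q.1 q.2, fun a b h => sl_inj q.1 q.2 a b h, rfl⟩
end

section
/- The graph K_11 □ K_7 has an L_8-decomposition. -/
open SimpleGraph

def sunBase : Fin 8 → Fin 11 × Fin 7 :=
  ![(0, 0), (1, 0), (3, 0), (6, 0), (4, 0), (1, 1), (3, 2), (6, 3)]

instance inst_s16 : DecidableRel sunlet8.Adj := fun a b => by
  unfold sunlet8
  rw [SimpleGraph.fromRel_adj]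
  infer_instance

theorem sunBase_inj : Function.Injective sunBase := by decide

set_option maxRecDepth 100000 in
set_option maxHeartbeats 4000000 in
theorem sunBase_unique : ∀ a b : Fin 8, sunlet8.Adj a b → ∀ c d : Fin 8, sunlet8.Adj c d →
    sunBase a - sunBase b = sunBase c - sunBase d → a = c := by decide +kernel

set_option maxRecDepth 100000 in
theorem sunBase_cover : ∀ d : Fin 11 × Fin 7, (d.1 ≠ 0 ∧ d.2 = 0) ∨ (d.2 ≠ 0 ∧ d.1 = 0) →
    ∃ a b : Fin 8, sunlet8.Adj a b ∧ sunBase a - sunBase b = d := by decide +kernel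

theorem sunBase_adj : ∀ a b : Fin 8, sunlet8.Adj a b →
    ((sunBase a - sunBase b).1 ≠ 0 ∧ (sunBase a - sunBase b).2 = 0) ∨
    ((sunBase a - sunBase b).2 ≠ 0 ∧ (sunBase a - sunBase b).1 = 0) := by decide +kernel

theorem box_adj_iff (x y : Fin 11 × Fin 7) :
    ((⊤ : SimpleGraph (Fin 11)) □ (⊤ : SimpleGraph (Fin 7))).Adj x y ↔
      ((x - y).1 ≠ 0 ∧ (x - y).2 = 0) ∨ ((x - y).2 ≠ 0 ∧ (x - y).1 = 0) := by
  simp [SimpleGraph.boxProd_adj, sub_eq_zero]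

def sunMap (g : Fin 11 × Fin 7) (i : Fin 8) : Fin 11 × Fin 7 := sunBase i + g

theorem sunMap_sub (g : Fin 11 × Fin 7) (a b : Fin 8) :
    sunMap g a - sunMap g b = sunBase a - sunBase b := by
  simp [sunMap]

theorem sunMap_eq {g g' : Fin 11 × Fin 7} {a b c d : Fin 8} (h : sunlet8.Adj a b)
    (h' : sunlet8.Adj c d) (h1 : sunMap g a = sunMap g' c) (h2 : sunMap g b = sunMap g' d) :
    g = g' := by
  have hd : sunBase a - sunBase b = sunBase c - sunBase d := by
    rw [← sunMap_sub g, ← sunMap_sub g', h1, h2]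
  have hac := sunBase_unique a b h c d h' hd
  subst hac
  exact add_left_cancel h1

theorem stmt_16 :
    HasSunletDecomposition ((⊤ : SimpleGraph (Fin 11)) □ (⊤ : SimpleGraph (Fin 7))) := by
  refine ⟨Set.range fun g => Sym2.map (sunMap g) '' sunlet8.edgeSet, ?_, ?_, ?_⟩
  · ext e
    induction e using Sym2.ind with
    | _ x y =>
    simp only [Set.sUnion_range, Set.mem_iUnion, SimpleGraph.mem_edgeSet]
    constructor
    · rintro ⟨g, e, he, hxy⟩
      induction e using Sym2.ind with
      | _ a b =>
      rw [SimpleGraph.mem_edgeSet] at he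
      rw [← SimpleGraph.mem_edgeSet, ← hxy, Sym2.map_mk, SimpleGraph.mem_edgeSet, box_adj_iff]
      simp only [sunMap_sub]
      exact sunBase_adj a b he
    · intro h
      obtain ⟨a, b, hab, hd⟩ := sunBase_cover _ ((box_adj_iff x y).1 h)
      refine ⟨x - sunBase a, s(a, b), hab, ?_⟩
      have h1 : sunMap (x - sunBase a) a = x := by simp [sunMap]
      have h2 : sunMap (x - sunBase a) b = y := by
        have h3 := sunMap_sub (x - sunBase a) a b
        rw [h1, hd] at h3
        exact sub_right_injective h3
      rw [Sym2.map_mk, h1, h2]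
  · rintro _ ⟨g, rfl⟩ _ ⟨g', rfl⟩ hne
    rw [Function.onFun, id, id, Set.disjoint_left]
    rintro _ ⟨e, he, rfl⟩ ⟨e', he', hee⟩
    apply hne
    suffices g = g' by rw [this]
    induction e using Sym2.ind with
    | _ a b =>
    induction e' using Sym2.ind with
    | _ c d =>
    rw [SimpleGraph.mem_edgeSet] at he he'
    rw [Sym2.map_mk, Sym2.map_mk, Sym2.eq_iff] at hee
    rcases hee with ⟨h1, h2⟩ | ⟨h1, h2⟩
    · exact (sunMap_eq he' he h1 h2).symm
    · exact (sunMap_eq he' he.symm h1 h2).symm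
  · rintro _ ⟨g, rfl⟩
    exact ⟨sunMap g, fun i j hij => sunBase_inj (add_right_cancel hij), rfl⟩
end
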